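/- Let (W,S) be a Coxeter system with root system Φ, let α ∈ Φ, w ∈ W, and p ∈ ℕ with p ≥ 1. Then: α is w-periodic if and only if α is w^p-periodic; α is w-even if and only if α is w^p-even; and α is w-odd if and only if α is w^p-odd. -/

import Mathlib

/-!
Statement 1: Let (W,S) be a Coxeter system with root system Φ, let α ∈ Φ, w ∈ W, and p ∈ ℕ
with p ≥ 1. Then: α is w-periodic iff α is w^p-periodic; α is w-even iff α is w^p-even;
and α is w-odd iff α is w^p-odd.
-/

noncomputable section

namespace CoxeterPaper

variable {B : Type*}

/-- The entry `⟨α_s, α_t⟩` of the canonical bilinear form: `-cos (π / m_{s,t})` if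
`m_{s,t} < ∞`, and `-1` if `m_{s,t} = ∞` (encoded by `M s t = 0`). -/
noncomputable def formEntry (M : CoxeterMatrix B) (s t : B) : ℝ :=
  if M s t = 0 then -1 else -Real.cos (Real.pi / (M s t : ℝ))

/-- The canonical bilinear form on `V = ⊕_{s ∈ S} ℝ α_s`, identified with `B → ℝ` via the
basis of simple roots. -/
noncomputable def canonicalForm [Fintype B] (M : CoxeterMatrix B) (x y : B → ℝ) : ℝ :=
  ∑ s, ∑ t, x s * y t * formEntry M s t

/-- The simple root `α_s`, i.e. the `s`-th standard basis vector of `B → ℝ`. -/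
def simpleRoot [DecidableEq B] (s : B) : B → ℝ := Pi.single s 1

variable [Fintype B] [DecidableEq B] {W : Type*} [Group W] {M : CoxeterMatrix B}

/-- `v` belongs to the root system `Φ = {w α_s : w ∈ W, s ∈ S}` (with respect to the
canonical representation `ρ`). -/
def IsRoot (ρ : W →* ((B → ℝ) ≃ₗ[ℝ] (B → ℝ))) (v : B → ℝ) : Prop :=
  ∃ (w : W) (s : B), v = ρ w (simpleRoot s)

/-- `v` is positive: all its coordinates in the basis of simple roots are nonnegative. -/
def IsPos (v : B → ℝ) : Prop := ∀ t, 0 ≤ v t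

/-- `v` is negative: `-v` is positive. -/
def IsNeg (v : B → ℝ) : Prop := IsPos (-v)

/-- The root `α` separates `u` and `v`: there is `ε ∈ {±1}` with `u α ∈ Φ^ε` and
`v α ∈ Φ^{-ε}`. -/
def Separates (ρ : W →* ((B → ℝ) ≃ₗ[ℝ] (B → ℝ))) (α : B → ℝ) (u v : W) : Prop :=
  (IsPos (ρ u α) ∧ IsNeg (ρ v α)) ∨ (IsNeg (ρ u α) ∧ IsPos (ρ v α))

/-- The set `{m ∈ ℤ : α separates w^m and w^{m+1}}`. -/
def sepSet (ρ : W →* ((B → ℝ) ≃ₗ[ℝ] (B → ℝ))) (w : W) (α : B → ℝ) : Set ℤ :=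
  {m : ℤ | Separates ρ α (w ^ m) (w ^ (m + 1))}

/-- `α` is `w`-periodic: `w^m α = α` for some `m ≥ 1`. -/
def IsPeriodic (ρ : W →* ((B → ℝ) ≃ₗ[ℝ] (B → ℝ))) (w : W) (α : B → ℝ) : Prop :=
  ∃ m : ℕ, 1 ≤ m ∧ ρ (w ^ m) α = α

/-- `α` is `w`-even: not `w`-periodic, and the set `{m ∈ ℤ : α separates w^m and w^{m+1}}`
is finite of even cardinality. -/
def IsWEven (ρ : W →* ((B → ℝ) ≃ₗ[ℝ] (B → ℝ))) (w : W) (α : B → ℝ) : Prop :=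
  ¬ IsPeriodic ρ w α ∧ (sepSet ρ w α).Finite ∧ Even (sepSet ρ w α).ncard

/-- `α` is `w`-odd: not `w`-periodic, and the set `{m ∈ ℤ : α separates w^m and w^{m+1}}`
is finite of odd cardinality. -/
def IsWOdd (ρ : W →* ((B → ℝ) ≃ₗ[ℝ] (B → ℝ))) (w : W) (α : B → ℝ) : Prop :=
  ¬ IsPeriodic ρ w α ∧ (sepSet ρ w α).Finite ∧ Odd (sepSet ρ w α).ncard

theorem formEntry_self {B : Type*} (M : CoxeterMatrix B) (s : B) : formEntry M s s = 1 := by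
  simp [formEntry]

theorem formEntry_comm {B : Type*} (M : CoxeterMatrix B) (s t : B) :
    formEntry M s t = formEntry M t s := by
  simp only [formEntry, M.symmetric s t]

theorem canonicalForm_comm {B : Type*} [Fintype B] (M : CoxeterMatrix B) (x y : B → ℝ) :
    canonicalForm M x y = canonicalForm M y x := by
  unfold canonicalForm
  rw [Finset.sum_comm]
  refine Finset.sum_congr rfl fun s _ => Finset.sum_congr rfl fun t _ => ?_
  rw [formEntry_comm]
  ring

theorem canonicalForm_add_left {B : Type*} [Fintype B] (M : CoxeterMatrix B) (x y z : B → ℝ) :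
    canonicalForm M (x + y) z = canonicalForm M x z + canonicalForm M y z := by
  simp only [canonicalForm, ← Finset.sum_add_distrib, Pi.add_apply, add_mul]

theorem canonicalForm_smul_left {B : Type*} [Fintype B] (M : CoxeterMatrix B) (c : ℝ)
    (x z : B → ℝ) : canonicalForm M (c • x) z = c * canonicalForm M x z := by
  simp only [canonicalForm, Finset.mul_sum, Pi.smul_apply, smul_eq_mul, mul_assoc]

theorem canonicalForm_sub_left {B : Type*} [Fintype B] (M : CoxeterMatrix B) (x y z : B → ℝ) :
    canonicalForm M (x - y) z = canonicalForm M x z - canonicalForm M y z := by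
  have h := canonicalForm_add_left M (x - y) y z
  rw [sub_add_cancel] at h
  linarith

theorem canonicalForm_simpleRoot (M : CoxeterMatrix B) (s t : B) :
    canonicalForm M (simpleRoot s) (simpleRoot t) = formEntry M s t := by
  simp [canonicalForm, simpleRoot, Pi.single_apply]

theorem canonicalForm_reflection_self (M : CoxeterMatrix B) (s : B) (x : B → ℝ) :
    canonicalForm M (x - (2 * canonicalForm M x (simpleRoot s)) • simpleRoot s)
      (x - (2 * canonicalForm M x (simpleRoot s)) • simpleRoot s) = canonicalForm M x x := by
  set c := canonicalForm M x (simpleRoot s) with hc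
  rw [canonicalForm_sub_left, canonicalForm_smul_left, canonicalForm_comm M x,
    canonicalForm_comm M (simpleRoot s), canonicalForm_sub_left, canonicalForm_sub_left,
    canonicalForm_smul_left, canonicalForm_smul_left, canonicalForm_simpleRoot, formEntry_self,
    canonicalForm_comm M (simpleRoot s) x, ← hc]
  ring

/-- The coefficients `sin (n θ) / sin θ` (or `n`, when `m_{s,t} = ∞`) of the roots of a dihedral
subsystem. -/
theorem exists_dihedral_coefficients {B : Type*} (M : CoxeterMatrix B) {s t : B} (hst : s ≠ t) :
    ∃ q : ℕ → ℝ, q 0 = 0 ∧ q 1 = 1 ∧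
      (∀ n, q (n + 2) = -(2 * formEntry M s t) * q (n + 1) - q n) ∧
      ∀ n, M s t = 0 ∨ n ≤ M s t → 0 ≤ q n := by
  by_cases h : M s t = 0
  · refine ⟨fun n => n, by simp, by simp, fun n => ?_, fun n _ => Nat.cast_nonneg n⟩
    simp only [formEntry, h, if_true]
    push_cast
    ring
  have h1 : M s t ≠ 1 := M.off_diagonal s t hst
  have h2 : (2 : ℝ) ≤ M s t := by exact_mod_cast (by omega : 2 ≤ M s t)
  set θ := Real.pi / (M s t : ℝ) with hθ
  have hπ := Real.pi_pos
  have hθ0 : 0 < θ := by positivity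
  have hmul : (M s t : ℝ) * θ = Real.pi := by rw [hθ]; field_simp
  have hθ1 : θ < Real.pi := by nlinarith
  have hsin := Real.sin_pos_of_pos_of_lt_pi hθ0 hθ1
  refine ⟨fun n => Real.sin (n * θ) / Real.sin θ, by simp, ?_, fun n => ?_, fun n hn => ?_⟩
  · simp [hsin.ne']
  · have e1 : ((n + 2 : ℕ) : ℝ) * θ = ((n + 1 : ℕ) : ℝ) * θ + θ := by push_cast; ring
    have e2 : (n : ℝ) * θ = ((n + 1 : ℕ) : ℝ) * θ - θ := by push_cast; ring
    simp only [formEntry, h, if_false, ← hθ]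
    rw [e1, e2, Real.sin_add, Real.sin_sub]
    ring
  · have hn' : (n : ℝ) ≤ M s t := by exact_mod_cast hn.resolve_left h
    refine div_nonneg (Real.sin_nonneg_of_nonneg_of_le_pi (by positivity) ?_) hsin.le
    rw [← hmul]
    gcongr

/-- Stripping an alternating suffix in `s, t` from `w`, as long as possible. -/
theorem exists_eq_mul_alternatingWord {B W : Type*} [Group W] {M : CoxeterMatrix B}
    (cs : CoxeterSystem M W) (w : W) (s t : B)
    (ht : cs.IsRightDescent w t) :
    ∃ (v : W) (k : ℕ), w = v * cs.wordProd (CoxeterSystem.alternatingWord s t k) ∧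
      cs.length w = cs.length v + k ∧ 0 < k ∧
      ¬ cs.IsRightDescent v s ∧ ¬ cs.IsRightDescent v t := by
  let P : ℕ → Prop := fun k => ∃ v : W,
    w = v * cs.wordProd (CoxeterSystem.alternatingWord s t k) ∧ cs.length w = cs.length v + k
  have hlen : ∀ {v : W} {r : B}, cs.IsRightDescent v r →
      cs.length (v * cs.simple r) + 1 = cs.length v := fun h => cs.isRightDescent_iff.1 h
  have hP1 : P 1 := by
    refine ⟨w * cs.simple t, ?_, (hlen ht).symm⟩
    simp [CoxeterSystem.alternatingWord]
  have hb : ∀ k, P k → k ≤ cs.length w := by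
    rintro k ⟨v, -, h⟩
    omega
  classical
  have hk := Nat.findGreatest_spec (P := P) (hb 1 hP1) hP1
  have hk1 := Nat.le_findGreatest (P := P) (hb 1 hP1) hP1
  have hmax : ∀ j, P j → j ≤ Nat.findGreatest P (cs.length w) :=
    fun j hj => Nat.le_findGreatest (hb j hj) hj
  generalize Nat.findGreatest P (cs.length w) = k at hk hk1 hmax
  obtain ⟨v, hv, hl⟩ := hk
  have hnext : ¬ cs.IsRightDescent v (if Even k then t else s) := by
    intro h
    have := hmax (k + 1) ⟨v * cs.simple (if Even k then t else s), ?_, ?_⟩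
    · omega
    · rw [CoxeterSystem.alternatingWord_succ', cs.wordProd_cons, mul_assoc,
        cs.simple_mul_simple_cancel_left]
      exact hv
    · have := hlen h
      omega
  have hprev : ¬ cs.IsRightDescent v (if Even k then s else t) := by
    intro h
    obtain ⟨j, rfl⟩ := Nat.exists_eq_add_of_le' hk1
    have hr : (if Even j then t else s) = (if Even (j + 1) then s else t) := by
      by_cases hj : Even j <;> simp [hj, Nat.even_add_one]
    rw [CoxeterSystem.alternatingWord_succ', cs.wordProd_cons, hr, ← mul_assoc] at hv
    have h1 := cs.length_mul_le (v * cs.simple (if Even (j + 1) then s else t))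
      (cs.wordProd (CoxeterSystem.alternatingWord s t j))
    rw [← hv] at h1
    have h2 := cs.length_wordProd_le (CoxeterSystem.alternatingWord s t j)
    rw [CoxeterSystem.length_alternatingWord] at h2
    have := hlen h
    omega
  refine ⟨v, k, hv, hl, hk1, ?_, ?_⟩
  · by_cases he : Even k <;> simp only [he, if_true, if_false] at hnext hprev <;> assumption
  · by_cases he : Even k <;> simp only [he, if_true, if_false] at hnext hprev <;> assumption

/-- If `s` is not a descent of `w = v * (⋯ s t)` with `k` letters in the alternating suffix and
lengths adding up, then `k < m_{s,t}`. -/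
theorem alternatingWord_length_lt {B W : Type*} [Group W] {M : CoxeterMatrix B}
    (cs : CoxeterSystem M W) {w v : W} {s t : B} {k : ℕ}
    (hw : w = v * cs.wordProd (CoxeterSystem.alternatingWord s t k))
    (hl : cs.length w = cs.length v + k) (hs : ¬ cs.IsRightDescent w s) (hM : M s t ≠ 0) :
    k < M s t := by
  by_contra hk
  have hred := cs.not_isReduced_alternatingWord t s (m := k + 1)
    (by rwa [M.symmetric]) (by rw [M.symmetric]; omega)
  have hle := cs.length_wordProd_le (CoxeterSystem.alternatingWord t s (k + 1))
  rw [CoxeterSystem.IsReduced] at hred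
  rw [CoxeterSystem.length_alternatingWord] at hred hle
  have hws : w * cs.simple s = v * cs.wordProd (CoxeterSystem.alternatingWord t s (k + 1)) := by
    rw [CoxeterSystem.alternatingWord_succ, cs.wordProd_concat, hw, mul_assoc]
  have h1 := cs.length_mul_le v (cs.wordProd (CoxeterSystem.alternatingWord t s (k + 1)))
  rw [← hws] at h1
  have h2 := cs.not_isRightDescent_iff.1 hs
  omega

theorem IsPos.add {B : Type*} {x y : B → ℝ} (hx : IsPos x) (hy : IsPos y) : IsPos (x + y) :=
  fun t => add_nonneg (hx t) (hy t)

theorem IsPos.smul {B : Type*} {c : ℝ} {x : B → ℝ} (hc : 0 ≤ c) (hx : IsPos x) :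
    IsPos (c • x) :=
  fun t => mul_nonneg hc (hx t)

theorem isPos_simpleRoot {B : Type*} [DecidableEq B] (s : B) : IsPos (simpleRoot s) := by
  intro t
  by_cases h : t = s <;> simp [simpleRoot, h]

/-- `ρ` is the canonical representation of the Coxeter system `cs`. -/
abbrev IsCanonicalRep (cs : CoxeterSystem M W) (ρ : W →* ((B → ℝ) ≃ₗ[ℝ] (B → ℝ))) : Prop :=
  ∀ (s : B) (x : B → ℝ), ρ (cs.simple s) x =
    x - (2 * canonicalForm M x (simpleRoot s)) • simpleRoot s

theorem IsRoot.apply {B W : Type*} [DecidableEq B] [Group W]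
    {ρ : W →* ((B → ℝ) ≃ₗ[ℝ] (B → ℝ))} {α : B → ℝ}
    (hα : IsRoot ρ α) (w : W) : IsRoot ρ (ρ w α) := by
  obtain ⟨u, s, rfl⟩ := hα
  exact ⟨w * u, s, by rw [map_mul, LinearEquiv.mul_apply]⟩

section Reflection

variable {cs : CoxeterSystem M W} {ρ : W →* ((B → ℝ) ≃ₗ[ℝ] (B → ℝ))}

theorem simple_apply_simpleRoot (hρ : IsCanonicalRep cs ρ) (s t : B) :
    ρ (cs.simple s) (simpleRoot t) = simpleRoot t - (2 * formEntry M s t) • simpleRoot s := by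
  rw [hρ, canonicalForm_simpleRoot, formEntry_comm]

theorem simple_apply_simpleRoot_self (hρ : IsCanonicalRep cs ρ) (s : B) :
    ρ (cs.simple s) (simpleRoot s) = -simpleRoot s := by
  rw [simple_apply_simpleRoot hρ, formEntry_self]
  module

theorem alternatingWord_apply_simpleRoot (hρ : IsCanonicalRep cs ρ)
    {s t : B} {q : ℕ → ℝ} (h0 : q 0 = 0) (h1 : q 1 = 1)
    (hq : ∀ n, q (n + 2) = -(2 * formEntry M s t) * q (n + 1) - q n) (k : ℕ) :
    ρ (cs.wordProd (CoxeterSystem.alternatingWord s t k)) (simpleRoot s) =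
      if Even k then q (k + 1) • simpleRoot s + q k • simpleRoot t
      else q (k + 1) • simpleRoot t + q k • simpleRoot s := by
  induction k with
  | zero => simp [CoxeterSystem.alternatingWord, h0, h1]
  | succ k ih =>
    rw [CoxeterSystem.alternatingWord_succ', cs.wordProd_cons, map_mul, LinearEquiv.mul_apply, ih]
    by_cases hk : Even k
    · simp only [hk, if_true, Nat.even_add_one, not_true, if_false, map_add, map_smul,
        simple_apply_simpleRoot hρ, formEntry_self, formEntry_comm M t s, hq]
      module
    · simp only [hk, if_false, Nat.even_add_one, not_false_eq_true, if_true, map_add, map_smul,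
        simple_apply_simpleRoot hρ, formEntry_self, hq]
      module

theorem isPos_of_not_isRightDescent (hρ : IsCanonicalRep cs ρ)
    (w : W) (s : B) (hs : ¬ cs.IsRightDescent w s) :
    IsPos (ρ w (simpleRoot s)) := by
  induction hn : cs.length w using Nat.strong_induction_on generalizing w s with
  | _ n ih =>
    subst hn
    by_cases hw : w = 1
    · simpa [hw] using isPos_simpleRoot s
    obtain ⟨t, ht⟩ := cs.exists_rightDescent_of_ne_one hw
    have hst : s ≠ t := by
      rintro rfl
      exact hs ht
    obtain ⟨v, k, hv, hl, hk, hvs, hvt⟩ := exists_eq_mul_alternatingWord cs w s t ht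
    have hlt : M s t = 0 ∨ k < M s t :=
      or_iff_not_imp_left.2 fun hM => alternatingWord_length_lt cs hv hl hs hM
    obtain ⟨q, h0, h1, hq, hpos⟩ := exists_dihedral_coefficients M hst
    have hps := ih (cs.length v) (by omega) v s hvs rfl
    have hpt := ih (cs.length v) (by omega) v t hvt rfl
    have hqk : 0 ≤ q k := hpos k (hlt.imp_right fun h => h.le)
    have hqk1 : 0 ≤ q (k + 1) := hpos (k + 1) hlt
    rw [hv, map_mul, LinearEquiv.mul_apply, alternatingWord_apply_simpleRoot hρ h0 h1 hq]
    split_ifs <;> rw [map_add, map_smul, map_smul] <;>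
      exact (IsPos.smul (by assumption) (by assumption)).add
        (IsPos.smul (by assumption) (by assumption))

theorem IsRoot.isPos_or_isNeg (hρ : IsCanonicalRep cs ρ)
    {α : B → ℝ} (hα : IsRoot ρ α) : IsPos α ∨ IsNeg α := by
  obtain ⟨w, s, rfl⟩ := hα
  by_cases hs : cs.IsRightDescent w s
  · right
    have h := isPos_of_not_isRightDescent hρ (w * cs.simple s) s
      (cs.isRightDescent_iff_not_isRightDescent_mul.1 hs)
    rwa [map_mul, LinearEquiv.mul_apply, simple_apply_simpleRoot_self hρ, map_neg] at h
  · exact Or.inl (isPos_of_not_isRightDescent hρ w s hs)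

theorem canonicalForm_apply_self (hρ : IsCanonicalRep cs ρ) (w : W) (x : B → ℝ) :
    canonicalForm M (ρ w x) (ρ w x) = canonicalForm M x x := by
  induction w using cs.simple_induction_left with
  | one => simp
  | mul_simple_left w i ih =>
    rw [map_mul, LinearEquiv.mul_apply, hρ, canonicalForm_reflection_self, ih]

theorem IsRoot.canonicalForm_self (hρ : IsCanonicalRep cs ρ)
    {α : B → ℝ} (hα : IsRoot ρ α) : canonicalForm M α α = 1 := by
  obtain ⟨w, s, rfl⟩ := hα
  rw [canonicalForm_apply_self hρ, canonicalForm_simpleRoot, formEntry_self]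

theorem IsRoot.isNeg_iff (hρ : IsCanonicalRep cs ρ)
    {α : B → ℝ} (hα : IsRoot ρ α) : IsNeg α ↔ ¬ IsPos α := by
  refine ⟨fun hn hp => ?_, fun h => (hα.isPos_or_isNeg hρ).resolve_left h⟩
  have h0 : α = 0 := funext fun t => le_antisymm (neg_nonneg.1 (hn t)) (hp t)
  have := hα.canonicalForm_self hρ
  simp [h0, canonicalForm] at this

/-- A simple reflection changes the sign of no root other than `±α_s`. -/
theorem IsRoot.eq_or_eq_neg_simpleRoot (hρ : IsCanonicalRep cs ρ)
    {β : B → ℝ} (hβ : IsRoot ρ β) {s : B}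
    (h : ¬ (IsPos β ↔ IsPos (ρ (cs.simple s) β))) :
    β = simpleRoot s ∨ β = -simpleRoot s := by
  have hcoord : ∀ t, t ≠ s → ρ (cs.simple s) β t = β t := by
    intro t ht
    simp [hρ, simpleRoot, ht]
  have hzero : ∀ t, t ≠ s → β t = 0 := by
    intro t ht
    have hc := hcoord t ht
    have hneg : ∀ γ, IsRoot ρ γ → ¬ IsPos γ → γ t ≤ 0 := fun γ hγ hn =>
      neg_nonneg.1 ((hγ.isNeg_iff hρ).2 hn t)
    by_cases hp : IsPos β
    · have := hneg _ (hβ.apply (cs.simple s)) (by tauto)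
      linarith [hp t]
    · have hp' : IsPos (ρ (cs.simple s) β) := by tauto
      linarith [hneg β hβ hp, hp' t]
  have hβs : β = β s • simpleRoot s := by
    funext t
    by_cases ht : t = s
    · simp [ht, simpleRoot]
    · simp [hzero t ht, simpleRoot, ht]
  have hsq : β s * β s = 1 := by
    have h1 := hβ.canonicalForm_self hρ
    rw [hβs, canonicalForm_smul_left, canonicalForm_comm, canonicalForm_smul_left,
      canonicalForm_simpleRoot, formEntry_self, mul_one] at h1
    exact h1
  rcases mul_self_eq_one_iff.1 hsq with h1 | h1 <;> rw [h1] at hβs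
  · left; simpa using hβs
  · right; simpa using hβs

/-- Every `w ∈ W` changes the sign of only finitely many roots. -/
theorem finite_sign_changes (hρ : IsCanonicalRep cs ρ) (w : W) :
    {β | IsRoot ρ β ∧ ¬ (IsPos β ↔ IsPos (ρ w β))}.Finite := by
  induction w using cs.simple_induction_left with
  | one => simp
  | mul_simple_left w s ih =>
    refine (ih.union (Set.toFinite {ρ w⁻¹ (simpleRoot s), ρ w⁻¹ (-simpleRoot s)})).subset ?_
    rintro β ⟨hβ, h⟩
    rw [map_mul, LinearEquiv.mul_apply] at h
    have hinv : ∀ γ, ρ w β = γ → β = ρ w⁻¹ γ := by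
      rintro _ rfl
      rw [← LinearEquiv.mul_apply, ← map_mul, inv_mul_cancel, map_one]
      rfl
    by_cases h' : IsPos β ↔ IsPos (ρ w β)
    · rw [h'] at h
      exact Or.inr (((hβ.apply w).eq_or_eq_neg_simpleRoot hρ h).imp (hinv _) (hinv _))
    · exact Or.inl ⟨hβ, h'⟩

theorem sepSet_eq (hρ : IsCanonicalRep cs ρ) {α : B → ℝ} (hα : IsRoot ρ α) (w : W) :
    sepSet ρ w α = {m : ℤ | ¬ (IsPos (ρ (w ^ m) α) ↔ IsPos (ρ (w ^ (m + 1)) α))} := by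
  ext m
  simp only [sepSet, Separates, Set.mem_ofPred_eq, (hα.apply _).isNeg_iff hρ]
  tauto

end Reflection

theorem injective_zpow_apply {B W : Type*} [Group W] {ρ : W →* ((B → ℝ) ≃ₗ[ℝ] (B → ℝ))}
    {w : W} {α : B → ℝ}
    (h : ¬ IsPeriodic ρ w α) : Function.Injective fun m : ℤ => ρ (w ^ m) α := by
  refine .of_lt_imp_ne fun m n hmn heq => h ⟨(n - m).toNat, by omega, ?_⟩
  have hn : w ^ n = w ^ m * w ^ (n - m).toNat := by
    rw [← zpow_natCast, ← zpow_add]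
    congr 1
    omega
  simp only [hn, map_mul, LinearEquiv.mul_apply] at heq
  exact ((ρ (w ^ m)).injective heq).symm

theorem finite_sepSet {cs : CoxeterSystem M W} {ρ : W →* ((B → ℝ) ≃ₗ[ℝ] (B → ℝ))}
    (hρ : IsCanonicalRep cs ρ)
    {α : B → ℝ} (hα : IsRoot ρ α) {w : W} (h : ¬ IsPeriodic ρ w α) :
    (sepSet ρ w α).Finite := by
  rw [sepSet_eq hρ hα]
  refine ((finite_sign_changes hρ w).preimage (injective_zpow_apply h).injOn).subset ?_
  intro m hm
  refine ⟨hα.apply _, ?_⟩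
  rwa [← LinearEquiv.mul_apply, ← map_mul, ← zpow_one_add, add_comm]

theorem isPeriodic_pow_iff {B W : Type*} [Group W] (ρ : W →* ((B → ℝ) ≃ₗ[ℝ] (B → ℝ))) (w : W)
    (α : B → ℝ) {p : ℕ} (hp : 1 ≤ p) : IsPeriodic ρ w α ↔ IsPeriodic ρ (w ^ p) α := by
  constructor
  · rintro ⟨m, hm, h⟩
    refine ⟨m, hm, ?_⟩
    rw [← pow_mul, mul_comm, pow_mul, map_pow, LinearEquiv.pow_apply]
    exact Function.iterate_fixed h p
  · rintro ⟨m, hm, h⟩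
    exact ⟨p * m, Nat.mul_pos hp hm, by rwa [pow_mul]⟩

open Classical in
/-- The number of changes of a sequence on an interval is even iff its end values agree. -/
theorem even_card_changes_iff (f : ℤ → Prop) {a b : ℤ} (hab : a ≤ b) :
    Even ((Finset.Ico a b).filter fun m => ¬ (f m ↔ f (m + 1))).card ↔ (f a ↔ f b) := by
  induction b, hab using Int.leInduction with
  | base => simp
  | succ b hab ih =>
    rw [← Finset.insert_Ico_right_eq_Ico_add_one hab, Finset.filter_insert]
    split_ifs with h
    · rw [ih]
      tauto
    · rw [Finset.card_insert_of_notMem (by simp), Nat.even_add_one, ih]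
      tauto

theorem even_ncard_changes_iff (f : ℤ → Prop) {a b : ℤ} (hab : a ≤ b)
    (hD : {m | ¬ (f m ↔ f (m + 1))} ⊆ Set.Ico a b) :
    Even {m | ¬ (f m ↔ f (m + 1))}.ncard ↔ (f a ↔ f b) := by
  classical
  rw [← even_card_changes_iff f hab, ← Set.ncard_coe_finset]
  have : {m | ¬ (f m ↔ f (m + 1))} =
      (((Finset.Ico a b).filter fun m => ¬ (f m ↔ f (m + 1)) : Finset ℤ) : Set ℤ) := by
    ext m
    simpa using fun h => hD h
  rw [← this]

theorem exists_subset_Ico_neg {D : Set ℤ} (hD : D.Finite) :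
    ∃ N : ℤ, 0 ≤ N ∧ D ⊆ Set.Ico (-N) N := by
  obtain ⟨a, ha⟩ := hD.bddBelow
  obtain ⟨b, hb⟩ := hD.bddAbove
  refine ⟨|a| + |b| + 1, by positivity, fun m hm => ⟨?_, ?_⟩⟩
  · have := ha hm
    have := neg_abs_le a
    have := abs_nonneg b
    omega
  · have := hb hm
    have := le_abs_self b
    have := abs_nonneg a
    omega

/-- Passing to every `p`-th term preserves the parity of the number of changes of a sequence. -/
theorem even_ncard_changes_mul_iff (f : ℤ → Prop) {p : ℤ} (hp : 1 ≤ p)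
    (hf : {m | ¬ (f m ↔ f (m + 1))}.Finite)
    (hg : {m | ¬ (f (p * m) ↔ f (p * (m + 1)))}.Finite) :
    Even {m | ¬ (f m ↔ f (m + 1))}.ncard ↔
      Even {m | ¬ (f (p * m) ↔ f (p * (m + 1)))}.ncard := by
  obtain ⟨N, hN, hsub⟩ := exists_subset_Ico_neg (hf.union hg)
  have hle : N ≤ p * N := le_mul_of_one_le_left hN hp
  rw [even_ncard_changes_iff f (a := p * -N) (b := p * N) (by linarith [mul_neg p N]) fun m hm => by
      have := hsub (Or.inl hm)
      exact ⟨by linarith [this.1, mul_neg p N], this.2.trans_le hle⟩]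
  rw [even_ncard_changes_iff (fun m => f (p * m)) (a := -N) (b := N) (by omega)
    fun m hm => hsub (Or.inr hm)]

/-- For `α ∈ Φ`, `w ∈ W` and `p ≥ 1`: `α` is `w`-periodic iff it is
`w^p`-periodic, `w`-even iff `w^p`-even, and `w`-odd iff `w^p`-odd. -/
theorem periodic_even_odd_pow_iff
    (cs : CoxeterSystem M W)
    (ρ : W →* ((B → ℝ) ≃ₗ[ℝ] (B → ℝ)))
    (hρ : ∀ (s : B) (x : B → ℝ), ρ (cs.simple s) x =
      x - (2 * canonicalForm M x (simpleRoot s)) • simpleRoot s)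
    (α : B → ℝ) (hα : IsRoot ρ α) (w : W) (p : ℕ) (hp : 1 ≤ p) :
    (IsPeriodic ρ w α ↔ IsPeriodic ρ (w ^ p) α) ∧
    (IsWEven ρ w α ↔ IsWEven ρ (w ^ p) α) ∧
    (IsWOdd ρ w α ↔ IsWOdd ρ (w ^ p) α) := by
  have hper := isPeriodic_pow_iff ρ w α hp
  have key : ¬ IsPeriodic ρ w α →
      ((sepSet ρ w α).Finite ∧ (sepSet ρ (w ^ p) α).Finite ∧
        (Even (sepSet ρ w α).ncard ↔ Even (sepSet ρ (w ^ p) α).ncard)) := by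
    intro h
    have h1 := finite_sepSet hρ hα h
    have h2 := finite_sepSet hρ hα (mt hper.2 h)
    refine ⟨h1, h2, ?_⟩
    rw [sepSet_eq hρ hα] at h1 h2 ⊢
    rw [sepSet_eq hρ hα]
    simp only [← zpow_natCast w p, ← zpow_mul] at h2 ⊢
    exact even_ncard_changes_mul_iff (fun m => IsPos (ρ (w ^ m) α)) (by exact_mod_cast hp) h1 h2
  refine ⟨hper, ?_, ?_⟩
  · simp only [IsWEven, ← hper]
    tauto
  · simp only [IsWOdd, ← hper, ← Nat.not_even_iff_odd]
    tauto

end CoxeterPaper
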